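/- For every z ∈ ℂ with |z| > 1, the contour integral identity -(1/(2π)) ∫_0^{2π} [(1 - Log(1 + e^{-iθ})) · e^{iθ}] / [(e^{iθ} - z)(1 - Log(1 + e^{iθ}))] dθ = ∫_{-1}^0 1 / ((t - z)(1 - log(1 + t))) dt holds, where the left side is -(1/(2πi)) ∮_{|t|=1} (1 - ln(1+t⁻¹)) / ((t-z)(1 - ln(1+t))) dt written in the parametrization t = e^{iθ}. -/

import Mathlib

open MeasureTheory intervalIntegral Real

open Filter Topology

/-- The integral of a function of `e^{iθ}` over a full period does not depend on the period. -/
lemma integral_exp_mul_I_zero_two_pi (f : ℂ → ℂ) :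
    ∫ θ in (0:ℝ)..(2 * π), f (Complex.exp ((θ : ℂ) * Complex.I)) =
      ∫ θ in (-π)..π, f (Complex.exp ((θ : ℂ) * Complex.I)) := by
  have hper : Function.Periodic (fun θ : ℝ ↦ f (Complex.exp ((θ : ℂ) * Complex.I))) (2 * π) := by
    intro θ
    have h := Complex.exp_mul_I_periodic (θ : ℂ)
    simp only at h ⊢
    push_cast
    rw [h]
  have h := hper.intervalIntegral_add_eq 0 (-π)
  rwa [zero_add, show -π + 2 * π = π by ring] at h

/-- Mean value property on the unit circle, parametrized by `[-π, π]`. -/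
lemma integral_exp_mul_I_of_differentiableOn {f : ℂ → ℂ} {R : ℝ} (hR : 1 < R)
    (hf : DifferentiableOn ℂ f (Metric.ball 0 R)) :
    ∫ θ in (-π)..π, f (Complex.exp ((θ : ℂ) * Complex.I)) = 2 * π * f 0 := by
  have hd : DiffContOnCl ℂ f (Metric.ball 0 |(1 : ℝ)|) := by
    refine DifferentiableOn.diffContOnCl (hf.mono ?_)
    rw [abs_one, closure_ball _ one_ne_zero]
    exact Metric.closedBall_subset_ball hR
  have h := hd.circleAverage
  rw [circleAverage_def] at h
  simp only [circleMap, zero_add, Complex.ofReal_one, one_mul] at h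
  rw [← integral_exp_mul_I_zero_two_pi, ← h, Complex.real_smul]
  push_cast
  rw [mul_inv_cancel_left₀ (by simp [pi_ne_zero])]

/-- If `f` is holomorphic near the closed unit disc, then integrating `θ f` along the unit circle
cut at `-1` amounts to integrating `f` over the segment `[-1, 0]`. -/
lemma integral_mul_exp_mul_I_of_differentiableOn {f : ℂ → ℂ} {R : ℝ} (hR : 1 < R)
    (hf : DifferentiableOn ℂ f (Metric.ball 0 R)) :
    ∫ θ in (-π)..π, (θ : ℂ) * (f (Complex.exp ((θ : ℂ) * Complex.I)) *
        (Complex.exp ((θ : ℂ) * Complex.I) * Complex.I)) =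
      -(2 * π) * ∫ t in (-1:ℝ)..0, f t := by
  obtain ⟨g, hg⟩ := hf.isExactOn_ball
  have hexp : ∀ θ : ℝ, Complex.exp ((θ : ℂ) * Complex.I) ∈ Metric.ball (0 : ℂ) R := fun θ ↦ by
    simpa [Complex.norm_exp_ofReal_mul_I] using hR
  have hseg : ∀ t ∈ Set.uIcc (-1 : ℝ) 0, (t : ℂ) ∈ Metric.ball (0 : ℂ) R := fun t ht ↦ by
    rw [Set.uIcc_of_le (by norm_num)] at ht
    rw [mem_ball_zero_iff, Complex.norm_real, Real.norm_eq_abs]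
    exact lt_of_le_of_lt (abs_le.2 ⟨ht.1, ht.2.trans zero_le_one⟩) hR
  have hgexp : ∀ θ : ℝ, HasDerivAt (fun θ : ℝ ↦ g (Complex.exp ((θ : ℂ) * Complex.I)))
      (f (Complex.exp ((θ : ℂ) * Complex.I)) *
        (Complex.exp ((θ : ℂ) * Complex.I) * Complex.I)) θ := fun θ ↦ by
    have h : HasDerivAt (fun w : ℂ ↦ Complex.exp (w * Complex.I))
        (Complex.exp ((θ : ℂ) * Complex.I) * Complex.I) (θ : ℂ) := by
      simpa using ((hasDerivAt_id (θ : ℂ)).mul_const Complex.I).cexp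
    exact (HasDerivAt.comp (θ : ℂ) (hg _ (hexp θ)) h).comp_ofReal
  have hfc : Continuous fun θ : ℝ ↦ f (Complex.exp ((θ : ℂ) * Complex.I)) :=
    hf.continuousOn.comp_continuous (by fun_prop) hexp
  have hseg_int : ∫ t in (-1:ℝ)..0, f t = g 0 - g (-1) := by
    rw [integral_eq_sub_of_hasDerivAt (f := fun t : ℝ ↦ g t)
      (fun t ht ↦ (hg _ (hseg t ht)).comp_ofReal)]
    · simp
    · exact (hf.continuousOn.comp (by fun_prop) hseg).intervalIntegrable
  rw [integral_mul_deriv_eq_deriv_mul (u := fun θ : ℝ ↦ (θ : ℂ)) (u' := fun _ ↦ 1)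
      (v := fun θ : ℝ ↦ g (Complex.exp ((θ : ℂ) * Complex.I)))
      (fun θ _ ↦ (hasDerivAt_id (θ : ℂ)).comp_ofReal) (fun θ _ ↦ hgexp θ)
      intervalIntegrable_const ((hfc.mul (by fun_prop)).intervalIntegrable _ _)]
  have hmean := integral_exp_mul_I_of_differentiableOn hR
    (fun w hw ↦ (hg w hw).differentiableAt.differentiableWithinAt)
  simp only [one_mul]
  rw [hmean, hseg_int, Complex.ofReal_neg, neg_mul (π : ℂ) Complex.I, Complex.exp_neg,
    Complex.exp_pi_mul_I]
  norm_num
  ring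

/-- The same identity for a bounded holomorphic function on the open unit disc that extends
continuously to the unit circle away from `-1`. -/
lemma integral_mul_exp_mul_I_of_bounded {f : ℂ → ℂ} {C : ℝ} (hm : Measurable f)
    (hf : DifferentiableOn ℂ f (Metric.ball 0 1))
    (hC : ∀ w ∈ Metric.ball (0 : ℂ) 1, ‖f w‖ ≤ C)
    (hc : ∀ w ∈ Metric.closedBall (0 : ℂ) 1, w ≠ -1 → ContinuousAt f w) :
    ∫ θ in (-π)..π, (θ : ℂ) * (f (Complex.exp ((θ : ℂ) * Complex.I)) *
        (Complex.exp ((θ : ℂ) * Complex.I) * Complex.I)) =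
      -(2 * π) * ∫ t in (-1:ℝ)..0, f t := by
  have hr : ∀ᶠ r : ℝ in 𝓝[<] 1, 0 < r ∧ r < 1 := by
    filter_upwards [Ioo_mem_nhdsLT (show (0 : ℝ) < 1 by norm_num)] with r hr using hr
  have hball : ∀ r : ℝ, 0 < r ∧ r < 1 → ∀ w ∈ Metric.closedBall (0 : ℂ) 1,
      (r : ℂ) * w ∈ Metric.ball (0 : ℂ) 1 := fun r hr w hw ↦ by
    rw [mem_closedBall_zero_iff] at hw
    rw [mem_ball_zero_iff, norm_mul, Complex.norm_real, Real.norm_of_nonneg hr.1.le]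
    nlinarith [norm_nonneg w]
  have hlim : ∀ w ∈ Metric.closedBall (0 : ℂ) 1, w ≠ -1 →
      Tendsto (fun r : ℝ ↦ f (r * w)) (𝓝[<] 1) (𝓝 (f w)) := fun w hw hw1 ↦ by
    have h : Tendsto (fun r : ℝ ↦ (r : ℂ) * w) (𝓝[<] 1) (𝓝 w) := by
      have h' : Continuous fun r : ℝ ↦ (r : ℂ) * w := by fun_prop
      simpa using (h'.tendsto 1).mono_left nhdsWithin_le_nhds
    exact (hc w hw hw1).tendsto.comp h
  have hexp : ∀ θ : ℝ, Complex.exp ((θ : ℂ) * Complex.I) ∈ Metric.closedBall (0 : ℂ) 1 :=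
    fun θ ↦ by simp [Complex.norm_exp_ofReal_mul_I]
  have hseg : ∀ t : ℝ, t ∈ Set.uIoc (-1 : ℝ) 0 → (t : ℂ) ∈ Metric.closedBall (0 : ℂ) 1 :=
    fun t ht ↦ by
      rw [Set.uIoc_of_le (by norm_num)] at ht
      rw [mem_closedBall_zero_iff, Complex.norm_real, Real.norm_eq_abs]
      exact abs_le.2 ⟨ht.1.le, ht.2.trans zero_le_one⟩
  have hcircle : Tendsto (fun r : ℝ ↦ ∫ θ in (-π)..π,
      (θ : ℂ) * (f (r * Complex.exp ((θ : ℂ) * Complex.I)) *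
        (Complex.exp ((θ : ℂ) * Complex.I) * Complex.I))) (𝓝[<] 1)
      (𝓝 (∫ θ in (-π)..π, (θ : ℂ) * (f (Complex.exp ((θ : ℂ) * Complex.I)) *
        (Complex.exp ((θ : ℂ) * Complex.I) * Complex.I)))) := by
    refine tendsto_integral_filter_of_dominated_convergence (fun θ ↦ |θ| * C) ?_ ?_ ?_ ?_
    · exact Eventually.of_forall fun r ↦ Measurable.aestronglyMeasurable (by fun_prop)
    · filter_upwards [hr] with r hr
      refine Eventually.of_forall fun θ _ ↦ ?_
      simp only [norm_mul, Complex.norm_real, Complex.norm_exp_ofReal_mul_I, Complex.norm_I,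
        mul_one, Real.norm_eq_abs]
      exact mul_le_mul_of_nonneg_left (hC _ (hball r hr _ (hexp θ))) (abs_nonneg θ)
    · exact Continuous.intervalIntegrable (by fun_prop) _ _
    · have hπ : ∀ᵐ θ : ℝ, θ ≠ π := by simp [ae_iff]
      filter_upwards [hπ] with θ hθ hmem
      rw [Set.uIoc_of_le (by linarith [pi_pos])] at hmem
      refine ((hlim _ (hexp θ) fun h ↦ hθ ?_).mul_const _).const_mul _
      have harg := Complex.arg_exp_mul_I θ
      rwa [h, Complex.arg_neg_one,
        (toIocMod_eq_self two_pi_pos).2 (by rwa [show -π + 2 * π = π by ring]), eq_comm] at harg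
  have hsegment : Tendsto (fun r : ℝ ↦ ∫ t in (-1:ℝ)..0, f (r * t)) (𝓝[<] 1)
      (𝓝 (∫ t in (-1:ℝ)..0, f t)) := by
    refine tendsto_integral_filter_of_dominated_convergence (fun _ ↦ C) ?_ ?_ ?_ ?_
    · exact Eventually.of_forall fun r ↦ Measurable.aestronglyMeasurable (by fun_prop)
    · filter_upwards [hr] with r hr
      exact Eventually.of_forall fun t ht ↦ hC _ (hball r hr _ (hseg t ht))
    · exact intervalIntegrable_const
    · refine Eventually.of_forall fun t ht ↦ hlim _ (hseg t ht) fun h ↦ ?_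
      rw [Set.uIoc_of_le (by norm_num)] at ht
      exact ht.1.ne' (by exact_mod_cast h)
  refine tendsto_nhds_unique (hcircle.congr' ?_) (hsegment.const_mul _)
  filter_upwards [hr] with r hr
  refine integral_mul_exp_mul_I_of_differentiableOn (f := fun w ↦ f (r * w)) (R := r⁻¹)
    ((one_lt_inv₀ hr.1).2 hr.2) (hf.comp (by fun_prop) fun w hw ↦ ?_)
  rw [mem_ball_zero_iff] at hw ⊢
  rw [norm_mul, Complex.norm_real, Real.norm_of_nonneg hr.1.le]
  calc r * ‖w‖ < r * r⁻¹ := by gcongr; exact hr.1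
    _ = 1 := mul_inv_cancel₀ hr.1.ne'

lemma log_one_add_exp_mul_I {θ : ℝ} (hθ : θ ∈ Set.Ioo (-π) π) :
    Complex.log (1 + Complex.exp ((θ : ℂ) * Complex.I)) =
      Real.log (2 * Real.cos (θ / 2)) + (θ / 2 : ℝ) * Complex.I := by
  have hcos : 0 < 2 * Real.cos (θ / 2) :=
    mul_pos two_pos (Real.cos_pos_of_mem_Ioo ⟨by linarith [hθ.1], by linarith [hθ.2]⟩)
  have h : 1 + Complex.exp ((θ : ℂ) * Complex.I) =
      (2 * Real.cos (θ / 2) : ℝ) * Complex.exp ((θ / 2 : ℝ) * Complex.I) := by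
    have h2 : Complex.exp ((θ : ℂ) * Complex.I) =
        Complex.exp ((θ / 2 : ℝ) * Complex.I) * Complex.exp ((θ / 2 : ℝ) * Complex.I) := by
      rw [← Complex.exp_add]; push_cast; ring_nf
    have h3 : Complex.exp (-((θ / 2 : ℝ) : ℂ) * Complex.I) *
        Complex.exp ((θ / 2 : ℝ) * Complex.I) = 1 := by
      rw [← Complex.exp_add]; simp
    rw [h2, Complex.ofReal_mul, Complex.ofReal_ofNat, Complex.ofReal_cos, Complex.two_cos, add_mul,
      h3, add_comm]
  rw [h, Complex.log_ofReal_mul hcos (Complex.exp_ne_zero _), Complex.log_exp] <;>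
    simp <;> linarith [hθ.1, hθ.2, pi_pos]

/-- `Log (1 + t⁻¹) = Log (1 + t) - Log t` on the unit circle away from `-1`. -/
lemma log_one_add_exp_neg_mul_I {θ : ℝ} (hθ : θ ∈ Set.Ioo (-π) π) :
    Complex.log (1 + Complex.exp (-(θ : ℂ) * Complex.I)) =
      Complex.log (1 + Complex.exp ((θ : ℂ) * Complex.I)) - θ * Complex.I := by
  have h := log_one_add_exp_mul_I (θ := -θ) ⟨by linarith [hθ.2], by linarith [hθ.1]⟩
  rw [Complex.ofReal_neg] at h
  rw [h, log_one_add_exp_mul_I hθ, neg_div, Real.cos_neg]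
  push_cast
  ring

lemma one_sub_log_two_le_norm_one_sub_log {w : ℂ} (hw : w ∈ Metric.closedBall (0 : ℂ) 1) :
    1 - Real.log 2 ≤ ‖1 - Complex.log (1 + w)‖ := by
  have hnorm : ‖1 + w‖ ≤ 2 := by
    rw [mem_closedBall_zero_iff] at hw
    calc ‖1 + w‖ ≤ ‖(1 : ℂ)‖ + ‖w‖ := norm_add_le _ _
      _ ≤ 2 := by rw [norm_one]; linarith
  have hlog : Real.log ‖1 + w‖ ≤ Real.log 2 := by
    rcases (norm_nonneg (1 + w)).eq_or_lt with h | h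
    · rw [← h, Real.log_zero]
      exact Real.log_nonneg one_le_two
    · exact Real.log_le_log h hnorm
  calc 1 - Real.log 2 ≤ (1 - Complex.log (1 + w)).re := by
        rw [Complex.sub_re, Complex.one_re, Complex.log_re]; linarith
    _ ≤ _ := Complex.re_le_norm _

lemma one_add_mem_slitPlane {w : ℂ} (hw : w ∈ Metric.closedBall (0 : ℂ) 1) (hw1 : w ≠ -1) :
    1 + w ∈ Complex.slitPlane := by
  rw [mem_closedBall_zero_iff] at hw
  rw [Complex.mem_slitPlane_iff]
  by_contra! h
  obtain ⟨hre, him⟩ := h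
  simp only [Complex.add_re, Complex.one_re, Complex.add_im, Complex.one_im, zero_add] at hre him
  have := (abs_le.1 ((Complex.abs_re_le_norm w).trans hw)).1
  exact hw1 (Complex.ext (by simp; linarith) (by simpa using him))

/-- The function `1 / ((t - z)(1 - Log (1 + t)))`. -/
noncomputable def cauchyLogKernel (z t : ℂ) : ℂ := 1 / ((t - z) * (1 - Complex.log (1 + t)))

section cauchyLogKernel

variable {z : ℂ}

lemma norm_sub_one_le_norm_sub {w : ℂ} (hw : w ∈ Metric.closedBall (0 : ℂ) 1) :
    ‖z‖ - 1 ≤ ‖w - z‖ := by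
  rw [mem_closedBall_zero_iff] at hw
  rw [norm_sub_rev]
  linarith [norm_sub_norm_le z w]

lemma sub_ne_zero_of_mem_closedBall (hz : 1 < ‖z‖) {w : ℂ}
    (hw : w ∈ Metric.closedBall (0 : ℂ) 1) : w - z ≠ 0 :=
  norm_pos_iff.1 (by linarith [norm_sub_one_le_norm_sub (z := z) hw])

lemma one_sub_log_two_pos : 0 < 1 - Real.log 2 := by
  linarith [Real.log_two_lt_d9]

lemma one_sub_log_ne_zero {w : ℂ} (hw : w ∈ Metric.closedBall (0 : ℂ) 1) :
    1 - Complex.log (1 + w) ≠ 0 :=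
  norm_pos_iff.1 (one_sub_log_two_pos.trans_le (one_sub_log_two_le_norm_one_sub_log hw))

lemma measurable_cauchyLogKernel : Measurable (cauchyLogKernel z) := by
  unfold cauchyLogKernel
  fun_prop

lemma differentiableAt_cauchyLogKernel (hz : 1 < ‖z‖) {w : ℂ}
    (hw : w ∈ Metric.closedBall (0 : ℂ) 1) (hw1 : w ≠ -1) :
    DifferentiableAt ℂ (cauchyLogKernel z) w := by
  have hlog : DifferentiableAt ℂ (fun w ↦ Complex.log (1 + w)) w :=
    DifferentiableAt.clog (by fun_prop) (one_add_mem_slitPlane hw hw1)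
  exact DifferentiableAt.div (by fun_prop) (by fun_prop)
    (mul_ne_zero (sub_ne_zero_of_mem_closedBall hz hw) (one_sub_log_ne_zero hw))

lemma norm_cauchyLogKernel_le (hz : 1 < ‖z‖) {w : ℂ} (hw : w ∈ Metric.closedBall (0 : ℂ) 1) :
    ‖cauchyLogKernel z w‖ ≤ 1 / ((‖z‖ - 1) * (1 - Real.log 2)) := by
  have h1 := norm_sub_one_le_norm_sub (z := z) hw
  have h2 := one_sub_log_two_le_norm_one_sub_log hw
  have h3 := one_sub_log_two_pos
  have h4 : 0 < ‖z‖ - 1 := by linarith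
  rw [cauchyLogKernel, norm_div, norm_one, norm_mul]
  gcongr

lemma integral_mul_exp_mul_I_cauchyLogKernel (hz : 1 < ‖z‖) :
    ∫ θ in (-π)..π, (θ : ℂ) * (cauchyLogKernel z (Complex.exp ((θ : ℂ) * Complex.I)) *
        (Complex.exp ((θ : ℂ) * Complex.I) * Complex.I)) =
      -(2 * π) * ∫ t in (-1:ℝ)..0, cauchyLogKernel z t :=
  integral_mul_exp_mul_I_of_bounded measurable_cauchyLogKernel
    (fun w hw ↦ (differentiableAt_cauchyLogKernel hz (Metric.ball_subset_closedBall hw)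
      fun h ↦ by simp [h] at hw).differentiableWithinAt)
    (fun _ hw ↦ norm_cauchyLogKernel_le hz (Metric.ball_subset_closedBall hw))
    (fun _ hw hw1 ↦ (differentiableAt_cauchyLogKernel hz hw hw1).continuousAt)

lemma intervalIntegrable_mul_cauchyLogKernel (hz : 1 < ‖z‖) :
    IntervalIntegrable (fun θ : ℝ ↦ (θ : ℂ) *
      (cauchyLogKernel z (Complex.exp ((θ : ℂ) * Complex.I)) *
        (Complex.exp ((θ : ℂ) * Complex.I) * Complex.I))) volume (-π) π := by
  have hm := measurable_cauchyLogKernel (z := z)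
  refine IntervalIntegrable.mono_fun'
    (g := fun θ ↦ |θ| * (1 / ((‖z‖ - 1) * (1 - Real.log 2))))
    (Continuous.intervalIntegrable (by fun_prop) _ _)
    (Measurable.aestronglyMeasurable (by fun_prop)) (Eventually.of_forall fun θ ↦ ?_)
  simp only [norm_mul, Complex.norm_real, Complex.norm_exp_ofReal_mul_I, Complex.norm_I,
    mul_one, Real.norm_eq_abs]
  exact mul_le_mul_of_nonneg_left
    (norm_cauchyLogKernel_le hz (by simp [Complex.norm_exp_ofReal_mul_I])) (abs_nonneg θ)

lemma integral_exp_mul_I_div_sub_eq_zero (hz : 1 < ‖z‖) :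
    ∫ θ in (-π)..π, Complex.exp ((θ : ℂ) * Complex.I) /
      (Complex.exp ((θ : ℂ) * Complex.I) - z) = 0 := by
  have h := integral_exp_mul_I_of_differentiableOn (f := fun w ↦ w / (w - z)) hz
    (DifferentiableOn.div (by fun_prop) (by fun_prop) fun w hw ↦ ?_)
  · simpa using h
  · rintro h
    rw [sub_eq_zero.1 h] at hw
    simp at hw

end cauchyLogKernel

/-- For `|z| > 1`, the contour integral of `ã(t)/(t-z)` over the unit circle
reduces to a real integral over the segment `[-1,0]`:
`-(1/2π) ∫_0^{2π} (1 - Log(1+e^{-iθ})) e^{iθ} / ((e^{iθ}-z)(1 - Log(1+e^{iθ}))) dθ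
  = ∫_{-1}^0 dt/((t-z)(1-log(1+t)))`. -/
theorem Q_tilde_a_eq_segment_integral (z : ℂ) (hz : 1 < ‖z‖) :
    -(1 / (2 * (π : ℂ))) * ∫ θ in (0:ℝ)..(2 * π),
        ((1 - Complex.log (1 + Complex.exp (-(θ : ℂ) * Complex.I))) *
            Complex.exp ((θ : ℂ) * Complex.I)) /
          ((Complex.exp ((θ : ℂ) * Complex.I) - z) *
            (1 - Complex.log (1 + Complex.exp ((θ : ℂ) * Complex.I)))) =
      ∫ t in (-1:ℝ)..0, 1 / (((t : ℂ) - z) * (1 - (Real.log (1 + t) : ℂ))) := by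
  have hperiod := integral_exp_mul_I_zero_two_pi fun w ↦
    ((1 - Complex.log (1 + w⁻¹)) * w) / ((w - z) * (1 - Complex.log (1 + w)))
  simp only [← Complex.exp_neg, ← neg_mul] at hperiod
  have hsplit : ∫ θ in (-π)..π,
      ((1 - Complex.log (1 + Complex.exp (-(θ : ℂ) * Complex.I))) *
          Complex.exp ((θ : ℂ) * Complex.I)) /
        ((Complex.exp ((θ : ℂ) * Complex.I) - z) *
          (1 - Complex.log (1 + Complex.exp ((θ : ℂ) * Complex.I)))) =
      ∫ θ in (-π)..π, (Complex.exp ((θ : ℂ) * Complex.I) /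
          (Complex.exp ((θ : ℂ) * Complex.I) - z) +
        (θ : ℂ) * (cauchyLogKernel z (Complex.exp ((θ : ℂ) * Complex.I)) *
          (Complex.exp ((θ : ℂ) * Complex.I) * Complex.I))) := by
    have hπ : ∀ᵐ θ : ℝ, θ ≠ π := by simp [ae_iff]
    refine integral_congr_ae ?_
    filter_upwards [hπ] with θ hθ hmem
    rw [Set.uIoc_of_le (by linarith [pi_pos])] at hmem
    have hball : Complex.exp ((θ : ℂ) * Complex.I) ∈ Metric.closedBall (0 : ℂ) 1 := by
      simp [Complex.norm_exp_ofReal_mul_I]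
    have h1 := sub_ne_zero_of_mem_closedBall hz hball
    have h2 := one_sub_log_ne_zero hball
    rw [log_one_add_exp_neg_mul_I ⟨hmem.1, lt_of_le_of_ne hmem.2 hθ⟩, cauchyLogKernel]
    field_simp
    ring
  have hcont : Continuous fun θ : ℝ ↦ Complex.exp ((θ : ℂ) * Complex.I) /
      (Complex.exp ((θ : ℂ) * Complex.I) - z) :=
    Continuous.div (by fun_prop) (by fun_prop) fun θ ↦
      sub_ne_zero_of_mem_closedBall hz (by simp [Complex.norm_exp_ofReal_mul_I])
  have hsegment : ∫ t in (-1:ℝ)..0, 1 / (((t : ℂ) - z) * (1 - (Real.log (1 + t) : ℂ))) =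
      ∫ t in (-1:ℝ)..0, cauchyLogKernel z t := by
    refine integral_congr fun t ht ↦ ?_
    rw [Set.uIcc_of_le (by norm_num)] at ht
    simp only [cauchyLogKernel]
    rw [Complex.ofReal_log (by linarith [ht.1])]
    push_cast
    rfl
  rw [hperiod, hsplit, integral_add (hcont.intervalIntegrable _ _)
    (intervalIntegrable_mul_cauchyLogKernel hz), integral_exp_mul_I_div_sub_eq_zero hz,
    integral_mul_exp_mul_I_cauchyLogKernel hz, hsegment]
  have hπ : (π : ℂ) ≠ 0 := Complex.ofReal_ne_zero.2 pi_ne_zero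
  field_simp
  ring
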